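/- (FDR consistency of the PRDN class.) For every ε > 0 there exists α_0 > 0 such that for every n, every null set N_0 ⊆ {1,…,n}, and every joint distribution of n p-values with super-uniform nulls satisfying the PRDN property, the Benjamini–Hochberg procedure at any level α ∈ (0, α_0) has FDR ≤ ε; that is, the class of all PRDN p-value distributions is FDR-consistent. -/

import Mathlib

open MeasureTheory Finset

attribute [local instance] Classical.propDecidable

/-- Number of rejections of the Benjamini–Hochberg (step-up) procedure at level `α`
applied to the family of p-values `p` indexed by `ι`: the largest `j` such that the
`j`-th smallest p-value is at most `α j / n` (equivalently, at least `j` of the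
p-values are at most `α j / n`), and `0` if there is no such `j ≥ 1`. -/
noncomputable def bhNumRejections {ι : Type*} [Fintype ι] (α : ℝ) (p : ι → ℝ) : ℕ :=
  Nat.findGreatest
    (fun j => j ≤ (Finset.univ.filter (fun i => p i ≤ α * (j : ℝ) / (Fintype.card ι : ℝ))).card)
    (Fintype.card ι)

/-- False discovery proportion `V / max{R, 1}` of the BH procedure at level `α`
with set of true null hypotheses `N₀`. -/
noncomputable def bhFDP {ι : Type*} [Fintype ι] (α : ℝ) (N₀ : Finset ι) (p : ι → ℝ) : ℝ :=
  ((N₀.filter (fun i => p i ≤ α * (bhNumRejections α p : ℝ) / (Fintype.card ι : ℝ))).card : ℝ) /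
    ((max (bhNumRejections α p) 1 : ℕ) : ℝ)

/-- False discovery rate (expected FDP) of the BH procedure at level `α`. -/
noncomputable def bhFDR {Ω : Type*} [MeasurableSpace Ω] {ι : Type*} [Fintype ι]
    (μ : Measure Ω) (α : ℝ) (N₀ : Finset ι) (p : ι → Ω → ℝ) : ℝ :=
  ∫ ω, bhFDP α N₀ (fun i => p i ω) ∂μ

/-- An increasing subset `D` of the cube `[0,1]^ι`: membership is preserved when
coordinates increase (while staying at most 1). -/
def IsIncreasingSet {ι : Type*} (D : Set (ι → ℝ)) : Prop :=
  (∀ x ∈ D, ∀ i, x i ∈ Set.Icc (0:ℝ) 1) ∧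
    ∀ x ∈ D, ∀ y : ι → ℝ, (∀ i, x i ≤ y i) → (∀ i, y i ≤ 1) → y ∈ D

/-- Positive regression dependence of the random vector `q`: for every increasing set
`D` and every coordinate `i`, the conditional probability `P(q ∈ D ∣ q i ≤ t)` is
non-decreasing in `t ∈ (0,1]` (stated in cross-multiplied form, so that no division
by a possibly vanishing probability occurs). -/
def PRD {Ω : Type*} [MeasurableSpace Ω] {ι : Type*} (μ : Measure Ω) (q : ι → Ω → ℝ) : Prop :=
  ∀ D : Set (ι → ℝ), IsIncreasingSet D → ∀ i : ι, ∀ s t : ℝ, 0 < s → s ≤ t → t ≤ 1 →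
    μ ({ω | (fun j => q j ω) ∈ D} ∩ {ω | q i ω ≤ s}) * μ {ω | q i ω ≤ t} ≤
      μ ({ω | (fun j => q j ω) ∈ D} ∩ {ω | q i ω ≤ t}) * μ {ω | q i ω ≤ s}

/-- PRDN (positive regression dependence within nulls): the subvector of null
p-values `(p i)_{i ∈ N₀}` satisfies PRD. -/
def PRDN {Ω : Type*} [MeasurableSpace Ω] {n : ℕ} (μ : Measure Ω)
    (N₀ : Finset (Fin n)) (p : Fin n → Ω → ℝ) : Prop :=
  PRD μ (fun (i : {i // i ∈ N₀}) ω => p i.1 ω)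

lemma bhNumRejections_le_card {ι : Type*} [Fintype ι] (α : ℝ) (p : ι → ℝ) :
    bhNumRejections α p ≤ Fintype.card ι :=
  Nat.findGreatest_le _

lemma bhNumRejections_le_card_filter {ι : Type*} [Fintype ι] (α : ℝ) (p : ι → ℝ) :
    bhNumRejections α p ≤
      (univ.filter fun i => p i ≤ α * (bhNumRejections α p : ℝ) / (Fintype.card ι : ℝ)).card :=
  Nat.findGreatest_spec
    (P := fun j : ℕ => j ≤ (univ.filter fun i => p i ≤ α * (j : ℝ) / (Fintype.card ι : ℝ)).card)
    (Nat.zero_le _) (Nat.zero_le _)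

lemma le_bhNumRejections {ι : Type*} [Fintype ι] {α : ℝ} {p : ι → ℝ} {j : ℕ}
    (h : j ≤ (univ.filter fun i => p i ≤ α * (j : ℝ) / (Fintype.card ι : ℝ)).card) :
    j ≤ bhNumRejections α p :=
  Nat.le_findGreatest (h.trans (card_le_univ _)) h

lemma card_filter_le_bhNumRejections {ι : Type*} [Fintype ι] {α : ℝ} (hα : 0 ≤ α) (p : ι → ℝ) :
    (univ.filter fun i => p i ≤ α * (bhNumRejections α p : ℝ) / (Fintype.card ι : ℝ)).card ≤
      bhNumRejections α p := by
  refine le_bhNumRejections (card_le_card fun i hi => ?_)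
  simp only [mem_filter, mem_univ, true_and] at hi ⊢
  refine hi.trans ?_
  have := bhNumRejections_le_card_filter α p
  gcongr

lemma bhNumRejections_antitone {ι : Type*} [Fintype ι] (α : ℝ) :
    Antitone (bhNumRejections α : (ι → ℝ) → ℕ) := by
  intro p q hpq
  refine le_bhNumRejections ((bhNumRejections_le_card_filter α q).trans
    (card_le_card fun i hi => ?_))
  simp only [mem_filter, mem_univ, true_and] at hi ⊢
  exact (hpq i).trans hi

lemma measurable_bhNumRejections {Ω ι : Type*} [MeasurableSpace Ω] [Fintype ι] (α : ℝ)
    {p : ι → Ω → ℝ} (hp : ∀ i, Measurable (p i)) :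
    Measurable fun ω => bhNumRejections α fun i => p i ω := by
  refine measurable_findGreatest fun k _ => ?_
  simp only [card_filter]
  refine measurableSet_le measurable_const (Finset.measurable_sum _ fun i _ => ?_)
  exact Measurable.ite (measurableSet_le (hp i) measurable_const) measurable_const measurable_const

lemma bhFDP_nonneg {ι : Type*} [Fintype ι] (α : ℝ) (N₀ : Finset ι) (p : ι → ℝ) :
    0 ≤ bhFDP α N₀ p := by
  unfold bhFDP; positivity

lemma bhFDP_le_one {ι : Type*} [Fintype ι] {α : ℝ} (hα : 0 ≤ α) (N₀ : Finset ι) (p : ι → ℝ) :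
    bhFDP α N₀ p ≤ 1 := by
  refine div_le_one_of_le₀ (Nat.cast_le.2 (le_max_of_le_left ?_)) (Nat.cast_nonneg _)
  exact (card_le_card (filter_subset_filter _ (subset_univ _))).trans
    (card_filter_le_bhNumRejections hα p)

/-- A large false discovery proportion at level `α` forces the procedure run on the null p-values
alone, at the inflated level `α / δ`, to reject. -/
lemma one_le_bhNumRejections_of_lt_bhFDP {ι : Type*} [Fintype ι] {α δ : ℝ} (hα : 0 ≤ α)
    (hδ : 0 < δ) {N₀ : Finset ι} {p : ι → ℝ} (h : δ < bhFDP α N₀ p) :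
    1 ≤ bhNumRejections (α / δ) (fun i : {i // i ∈ N₀} => p i.1) := by
  set R := bhNumRejections α p with hR
  set V := (N₀.filter fun i => p i ≤ α * (R : ℝ) / (Fintype.card ι : ℝ)).card with hV
  have hmax : (1 : ℝ) ≤ ((max R 1 : ℕ) : ℝ) := by exact_mod_cast le_max_right R 1
  have hmax' : (R : ℝ) ≤ ((max R 1 : ℕ) : ℝ) := by exact_mod_cast le_max_left R 1
  have hlt : δ * ((max R 1 : ℕ) : ℝ) < V := (lt_div_iff₀ (by linarith)).1 h
  have hVpos : 0 < V := by
    have : (0 : ℝ) < V := lt_of_le_of_lt (by positivity) hlt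
    exact_mod_cast this
  have hN₀ : 0 < N₀.card := hVpos.trans_le (card_le_card (filter_subset _ _))
  have hRV : (R : ℝ) ≤ V / δ := by
    rw [le_div_iff₀ hδ, mul_comm]
    exact (mul_le_mul_of_nonneg_left hmax' hδ.le).trans hlt.le
  have hthr : α * (R : ℝ) / (Fintype.card ι : ℝ) ≤
      α / δ * (V : ℝ) / (Fintype.card {i // i ∈ N₀} : ℝ) := by
    rw [Fintype.card_coe, div_mul_eq_mul_div, mul_div_assoc α (V : ℝ)]
    have : N₀.card ≤ Fintype.card ι := card_le_univ _
    gcongr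
  refine hVpos.trans_le (le_bhNumRejections ?_)
  rw [← card_map (Function.Embedding.subtype _), hV]
  refine card_le_card fun i hi => ?_
  rw [mem_filter] at hi
  simp only [mem_map, mem_filter, mem_univ, true_and]
  exact ⟨⟨i, hi.1⟩, hi.2.trans hthr, rfl⟩

lemma isIncreasingSet_bhNumRejections_le {ι : Type*} [Fintype ι] (α : ℝ) (k : ℕ) :
    IsIncreasingSet {v : ι → ℝ | (∀ i, v i ∈ Set.Icc (0 : ℝ) 1) ∧ bhNumRejections α v ≤ k} :=
  ⟨fun _ hx => hx.1, fun _ hx _ hxy hy =>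
    ⟨fun i => ⟨(hx.1 i).1.trans (hxy i), hy i⟩, (bhNumRejections_antitone α hxy).trans hx.2⟩⟩

section Simes

variable {Ω κ : Type*} [MeasurableSpace Ω] [Fintype κ] {μ : Measure Ω} [IsProbabilityMeasure μ]
  {q : κ → Ω → ℝ}

lemma PRD.measureReal_mul_le (h01 : ∀ i ω, q i ω ∈ Set.Icc (0 : ℝ) 1) (hprd : PRD μ q)
    (α : ℝ) (k : ℕ) (i : κ) {s t : ℝ} (hs : 0 < s) (hst : s ≤ t) (ht : t ≤ 1) :
    μ.real ({ω | (bhNumRejections α fun i => q i ω) ≤ k} ∩ {ω | q i ω ≤ s}) *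
        μ.real {ω | q i ω ≤ t} ≤
      μ.real ({ω | (bhNumRejections α fun i => q i ω) ≤ k} ∩ {ω | q i ω ≤ t}) *
        μ.real {ω | q i ω ≤ s} := by
  have h := hprd _ (isIncreasingSet_bhNumRejections_le α k) i s t hs hst ht
  have hset : {ω | (fun j => q j ω) ∈
      {v : κ → ℝ | (∀ i, v i ∈ Set.Icc (0 : ℝ) 1) ∧ bhNumRejections α v ≤ k}} =
      {ω | (bhNumRejections α fun i => q i ω) ≤ k} := by
    ext ω
    exact and_iff_right fun i => h01 i ω
  rw [hset] at h
  simpa only [measureReal_def, ENNReal.toReal_mul] using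
    ENNReal.toReal_mono (ENNReal.mul_ne_top (measure_ne_top _ _) (measure_ne_top _ _)) h

lemma PRD.sum_inv_mul_measureReal_le (hq : ∀ i, Measurable (q i))
    (h01 : ∀ i ω, q i ω ∈ Set.Icc (0 : ℝ) 1) (hprd : PRD μ q) {i : κ}
    (hsuper : ∀ t ∈ Set.Icc (0 : ℝ) 1, μ {ω | q i ω ≤ t} ≤ ENNReal.ofReal t)
    {x : ℝ} (hx : 0 < x) (hx1 : x ≤ 1) :
    ∑ j ∈ range (Fintype.card κ), ((j + 1 : ℕ) : ℝ)⁻¹ *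
        μ.real ({ω | (bhNumRejections x fun i => q i ω) = j + 1} ∩
          {ω | q i ω ≤ x * ((j + 1 : ℕ) : ℝ) / Fintype.card κ}) ≤
      x / Fintype.card κ := by
  set m := Fintype.card κ
  have hm : (0 : ℝ) < m := Nat.cast_pos.2 (Fintype.card_pos_iff.2 ⟨i⟩)
  set R : Ω → ℕ := fun ω => bhNumRejections x fun i => q i ω
  have hR : Measurable R := measurable_bhNumRejections x hq
  set t : ℕ → ℝ := fun j => x * (j : ℝ) / m
  set F : ℕ → ℝ := fun j => μ.real {ω | q i ω ≤ t j}
  set g : ℕ → ℝ := fun j => μ.real ({ω | R ω ≤ j} ∩ {ω | q i ω ≤ t j}) / F j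
  have hg0 : ∀ j, 0 ≤ g j := fun j => div_nonneg measureReal_nonneg measureReal_nonneg
  have hg1 : ∀ j, g j ≤ 1 := fun j =>
    div_le_one_of_le₀ (measureReal_mono Set.inter_subset_right) measureReal_nonneg
  have htmono : Monotone t := fun a b hab => by
    have : (a : ℝ) ≤ b := by exact_mod_cast hab
    simp only [t]; gcongr
  have ht1 : ∀ j ≤ m, t j ≤ 1 := fun j hj => by
    have : (j : ℝ) ≤ m := by exact_mod_cast hj
    refine div_le_one_of_le₀ ?_ hm.le
    nlinarith [(Nat.cast_nonneg j : (0 : ℝ) ≤ j)]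
  have ht0 : ∀ j : ℕ, 0 ≤ t j := fun j => by simp only [t]; positivity
  have hFle : ∀ j ≤ m, F j ≤ t j := fun j hj =>
    ENNReal.toReal_le_of_le_ofReal (ht0 j) (hsuper _ ⟨ht0 j, ht1 j hj⟩)
  have hstep : ∀ j ∈ range m, ((j + 1 : ℕ) : ℝ)⁻¹ *
      μ.real ({ω | R ω = j + 1} ∩ {ω | q i ω ≤ t (j + 1)}) ≤ x / m * (g (j + 1) - g j) := by
    intro j hj
    have hjm : j + 1 ≤ m := mem_range.1 hj
    set A := {ω | q i ω ≤ t (j + 1)}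
    have hsplit : μ.real ({ω | R ω = j + 1} ∩ A) =
        μ.real ({ω | R ω ≤ j + 1} ∩ A) - μ.real ({ω | R ω ≤ j} ∩ A) := by
      have hset : {ω | R ω ≤ j + 1} ∩ A =
          ({ω | R ω = j + 1} ∩ A) ∪ ({ω | R ω ≤ j} ∩ A) := by
        ext ω
        simp only [Set.mem_inter_iff, Set.mem_union, Set.mem_ofPred_eq]
        have : R ω ≤ j + 1 ↔ R ω = j + 1 ∨ R ω ≤ j := by omega
        tauto
      rw [hset, measureReal_union]
      · ring
      · refine Set.disjoint_left.2 fun ω h₁ h₂ => ?_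
        have h₁ : R ω = j + 1 := h₁.1
        have h₂ : R ω ≤ j := h₂.1
        omega
      · exact (measurableSet_le hR measurable_const).inter
          (measurableSet_le (hq i) measurable_const)
    rcases (measureReal_nonneg : 0 ≤ F (j + 1)).eq_or_lt with hF | hF
    · have hz : ∀ B : Set Ω, μ.real (B ∩ A) = 0 := fun B =>
        le_antisymm ((measureReal_mono Set.inter_subset_right).trans hF.ge) measureReal_nonneg
      have hFj : F j = 0 := le_antisymm
        ((measureReal_mono fun ω (hω : q i ω ≤ t j) =>
          hω.trans (htmono j.le_succ)).trans hF.ge) measureReal_nonneg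
      have hgz : g (j + 1) = 0 := by simp only [g]; rw [show F (j + 1) = 0 from hF.symm, div_zero]
      have hgz' : g j = 0 := by simp only [g, hFj, div_zero]
      rw [hz, hgz, hgz', sub_zero, mul_zero, mul_zero]
    · have hgj : g j ≤ μ.real ({ω | R ω ≤ j} ∩ A) / F (j + 1) := by
        rcases (measureReal_nonneg : 0 ≤ F j).eq_or_lt with hFj | hFj
        · have hgz : g j = 0 := by simp only [g]; rw [show F j = 0 from hFj.symm, div_zero]
          rw [hgz]
          exact div_nonneg measureReal_nonneg hF.le
        · rcases Nat.eq_zero_or_pos j with rfl | hj0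
          · have : F 0 ≤ 0 := by simpa [t] using hFle 0 (Nat.zero_le _)
            exact absurd hFj this.not_gt
          · rw [div_le_div_iff₀ hFj hF]
            refine hprd.measureReal_mul_le h01 x j i ?_ (htmono j.le_succ) (ht1 _ hjm)
            have : (0 : ℝ) < j := by exact_mod_cast hj0
            simp only [t]; positivity
      have hinv : ((j + 1 : ℕ) : ℝ)⁻¹ ≤ x / m / F (j + 1) := by
        have hj1 : (0 : ℝ) < ((j + 1 : ℕ) : ℝ) := by positivity
        rw [le_div_iff₀ hF, inv_mul_le_iff₀ hj1]
        refine (hFle _ hjm).trans_eq ?_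
        simp only [t]; ring
      calc ((j + 1 : ℕ) : ℝ)⁻¹ * μ.real ({ω | R ω = j + 1} ∩ A)
          ≤ x / m / F (j + 1) * μ.real ({ω | R ω = j + 1} ∩ A) :=
            mul_le_mul_of_nonneg_right hinv measureReal_nonneg
        _ = x / m * (g (j + 1) - μ.real ({ω | R ω ≤ j} ∩ A) / F (j + 1)) := by
            rw [hsplit]; simp only [g, A]; ring
        _ ≤ x / m * (g (j + 1) - g j) := by gcongr
  calc _ ≤ ∑ j ∈ range m, x / m * (g (j + 1) - g j) := sum_le_sum hstep
    _ = x / m * (g m - g 0) := by rw [← mul_sum, sum_range_sub]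
    _ ≤ x / m * 1 := by
        gcongr
        linarith [hg0 0, hg1 m]
    _ = x / m := mul_one _

/-- Simes' inequality under positive regression dependence. -/
lemma PRD.measureReal_one_le_bhNumRejections_le (hq : ∀ i, Measurable (q i))
    (h01 : ∀ i ω, q i ω ∈ Set.Icc (0 : ℝ) 1) (hprd : PRD μ q)
    (hsuper : ∀ i, ∀ t ∈ Set.Icc (0 : ℝ) 1, μ {ω | q i ω ≤ t} ≤ ENNReal.ofReal t)
    {x : ℝ} (hx : 0 < x) (hx1 : x ≤ 1) :
    μ.real {ω | 1 ≤ bhNumRejections x fun i => q i ω} ≤ x := by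
  set m := Fintype.card κ
  set R : Ω → ℕ := fun ω => bhNumRejections x fun i => q i ω
  have hR : Measurable R := measurable_bhNumRejections x hq
  set S : κ → ℕ → Set Ω := fun i j =>
    {ω | R ω = j + 1} ∩ {ω | q i ω ≤ x * ((j + 1 : ℕ) : ℝ) / m}
  have hS : ∀ i j, MeasurableSet (S i j) := fun i j =>
    (measurableSet_eq_fun hR measurable_const).inter (measurableSet_le (hq i) measurable_const)
  have hlevel : ∀ j, μ.real {ω | R ω = j + 1} ≤ ∑ i, ((j + 1 : ℕ) : ℝ)⁻¹ * μ.real (S i j) := by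
    intro j
    have hindic : ∀ i, Integrable ((S i j).indicator (1 : Ω → ℝ)) μ := fun i =>
      (integrable_const (1 : ℝ)).indicator (hS i j)
    have hj1 : (0 : ℝ) < ((j + 1 : ℕ) : ℝ) := by positivity
    rw [← mul_sum, le_inv_mul_iff₀ hj1]
    have hRj : MeasurableSet {ω | R ω = j + 1} := measurableSet_eq_fun hR measurable_const
    calc ((j + 1 : ℕ) : ℝ) * μ.real {ω | R ω = j + 1}
        = ∫ ω, ((j + 1 : ℕ) : ℝ) * ({ω | R ω = j + 1}).indicator (1 : Ω → ℝ) ω ∂μ := by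
          rw [integral_const_mul, integral_indicator_one hRj]
      _ ≤ ∫ ω, ∑ i, (S i j).indicator (1 : Ω → ℝ) ω ∂μ := by
          refine integral_mono
            (((integrable_const (1 : ℝ)).indicator hRj).const_mul _)
            (integrable_finsetSum _ fun i _ => hindic i) fun ω => ?_
          by_cases hω : R ω = j + 1
          · have hcard := bhNumRejections_le_card_filter x fun i => q i ω
            change R ω ≤ (univ.filter fun i => q i ω ≤ x * (R ω : ℝ) / m).card at hcard
            rw [hω] at hcard
            have hsum : ∑ i, (S i j).indicator (1 : Ω → ℝ) ω =
                ((univ.filter fun i => q i ω ≤ x * ((j + 1 : ℕ) : ℝ) / m).card : ℝ) := by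
              simp only [S, Set.indicator_apply, Set.mem_inter_iff, Set.mem_ofPred_eq, hω,
                true_and, Pi.one_apply, sum_boole]
            simp only [hsum]
            simpa [Set.indicator_apply, hω] using
              (Nat.cast_le (α := ℝ)).2 hcard
          · simp only [Set.indicator_apply, Set.mem_ofPred_eq, hω, if_false, mul_zero]
            exact sum_nonneg fun i _ => by split_ifs <;> simp
      _ = ∑ i, μ.real (S i j) := by
          rw [integral_finsetSum _ fun i _ => hindic i]
          exact sum_congr rfl fun i _ => integral_indicator_one (hS i j)
  have hcover : {ω | 1 ≤ R ω} ⊆ ⋃ j ∈ range m, {ω | R ω = j + 1} := by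
    intro ω hω
    have h1 : 1 ≤ R ω := hω
    have h2 : R ω ≤ m := bhNumRejections_le_card _ _
    simp only [Set.mem_iUnion, Set.mem_ofPred_eq, mem_range]
    exact ⟨R ω - 1, by omega, by omega⟩
  calc μ.real {ω | 1 ≤ R ω}
      ≤ μ.real (⋃ j ∈ range m, {ω | R ω = j + 1}) := measureReal_mono hcover (measure_ne_top _ _)
    _ ≤ ∑ j ∈ range m, μ.real {ω | R ω = j + 1} := measureReal_biUnion_finset_le _ _
    _ ≤ ∑ j ∈ range m, ∑ i, ((j + 1 : ℕ) : ℝ)⁻¹ * μ.real (S i j) :=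
        sum_le_sum fun j _ => hlevel j
    _ = ∑ i, ∑ j ∈ range m, ((j + 1 : ℕ) : ℝ)⁻¹ * μ.real (S i j) := sum_comm
    _ ≤ ∑ _i : κ, x / m :=
        sum_le_sum fun i _ => hprd.sum_inv_mul_measureReal_le hq h01 (hsuper i) hx hx1
    _ = m * (x / m) := by rw [sum_const, nsmul_eq_mul, card_univ]
    _ ≤ x := by
        rcases (Nat.cast_nonneg m : (0 : ℝ) ≤ m).eq_or_lt with hm | hm
        · rw [← hm, zero_mul]
          exact hx.le
        · exact (mul_div_cancel₀ x hm.ne').le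

end Simes

/-- Under PRDN, `FDR ≤ δ + α / δ` whenever `α ≤ δ`. -/
lemma PRDN.bhFDR_le {Ω : Type*} [MeasurableSpace Ω] {μ : Measure Ω} [IsProbabilityMeasure μ]
    {n : ℕ} {p : Fin n → Ω → ℝ} {N₀ : Finset (Fin n)} (hp : ∀ i, Measurable (p i))
    (h01 : ∀ i ω, p i ω ∈ Set.Icc (0 : ℝ) 1)
    (hsuper : ∀ i ∈ N₀, ∀ t ∈ Set.Icc (0 : ℝ) 1, μ {ω | p i ω ≤ t} ≤ ENNReal.ofReal t)
    (hprdn : PRDN μ N₀ p) {α δ : ℝ} (hα : 0 < α) (hαδ : α ≤ δ) :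
    bhFDR μ α N₀ p ≤ δ + α / δ := by
  have hδ : 0 < δ := hα.trans_le hαδ
  set B : Set Ω := {ω | 1 ≤ bhNumRejections (α / δ) fun i : {i // i ∈ N₀} => p i.1 ω}
  have hB : MeasurableSet B := measurableSet_le measurable_const
    (measurable_bhNumRejections _ fun i : {i // i ∈ N₀} => hp i.1)
  have hBle : μ.real B ≤ α / δ :=
    PRD.measureReal_one_le_bhNumRejections_le (q := fun (i : {i // i ∈ N₀}) ω => p i.1 ω)
      (fun i => hp i.1) (fun i => h01 i.1) hprdn
      (fun i => hsuper i.1 i.2) (div_pos hα hδ) ((div_le_one hδ).2 hαδ)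
  have hindic : Integrable (B.indicator (1 : Ω → ℝ)) μ := (integrable_const (1 : ℝ)).indicator hB
  calc bhFDR μ α N₀ p ≤ ∫ ω, (δ + B.indicator (1 : Ω → ℝ) ω) ∂μ := by
        refine integral_mono_of_nonneg (.of_forall fun ω => bhFDP_nonneg _ _ _)
          ((integrable_const δ).add hindic) (.of_forall fun ω => ?_)
        by_cases hω : ω ∈ B
        · simp only [Set.indicator_of_mem hω, Pi.one_apply]
          linarith [bhFDP_le_one hα.le N₀ fun i => p i ω]
        · simp only [Set.indicator_of_notMem hω, add_zero]
          exact not_lt.1 fun h => hω (one_le_bhNumRejections_of_lt_bhFDP hα.le hδ h)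
    _ = δ + μ.real B := by
        rw [integral_add (integrable_const δ) hindic, integral_indicator_one hB]
        simp
    _ ≤ δ + α / δ := by gcongr

/-- **FDR consistency of the PRDN class.** For every `ε > 0` there exists `α₀ > 0`
such that for every `n`, every null set `N₀ ⊆ {1,…,n}`, and every joint distribution
of `n` p-values with super-uniform nulls satisfying the PRDN property, the BH
procedure at any level `α ∈ (0, α₀)` has `FDR ≤ ε`. -/
theorem prdn_class_fdr_consistent :
    ∀ ε : ℝ, 0 < ε → ∃ α₀ : ℝ, 0 < α₀ ∧
      ∀ (Ω : Type) (_ : MeasurableSpace Ω) (μ : Measure Ω), IsProbabilityMeasure μ →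
        ∀ (n : ℕ) (p : Fin n → Ω → ℝ) (N₀ : Finset (Fin n)),
          (∀ i, Measurable (p i)) →
          (∀ i ω, p i ω ∈ Set.Icc (0:ℝ) 1) →
          (∀ i ∈ N₀, ∀ t ∈ Set.Icc (0:ℝ) 1, μ {ω | p i ω ≤ t} ≤ ENNReal.ofReal t) →
          PRDN μ N₀ p →
          ∀ α : ℝ, 0 < α → α < α₀ → bhFDR μ α N₀ p ≤ ε := by
  intro ε hε
  have hδ : 0 < min (ε / 2) 1 := by positivity
  refine ⟨min (ε / 2) 1 * min (ε / 2) 1, by positivity, ?_⟩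
  intro Ω _ μ _ n p N₀ hp h01 hsuper hprdn α hα hα₀
  have h1 : min (ε / 2) 1 ≤ 1 := min_le_right _ _
  have h2 : min (ε / 2) 1 ≤ ε / 2 := min_le_left _ _
  have hdiv : α / min (ε / 2) 1 ≤ min (ε / 2) 1 := (div_le_iff₀ hδ).2 hα₀.le
  have := hprdn.bhFDR_le hp h01 hsuper hα (hα₀.le.trans (mul_le_of_le_one_left hδ.le h1))
  linarith
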